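/- There exists a simple graph G on vertex set ℕ such that every vertex of G has finite degree, the chromatic number of G equals 6, and G has no integral realization. -/

import Mathlib

/-- An integral realization of a simple graph `G`: an injective map of the
vertices into the Euclidean plane such that no three image points are
collinear, and two distinct vertices are adjacent iff their images are at
integer distance. -/
def IsIntegralRealization {V : Type*} (G : SimpleGraph V)
    (f : V → EuclideanSpace ℝ (Fin 2)) : Prop :=
  Function.Injective f ∧
  (∀ p q r : EuclideanSpace ℝ (Fin 2), p ∈ Set.range f → q ∈ Set.range f →
      r ∈ Set.range f → p ≠ q → q ≠ r → p ≠ r →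
      ¬ Collinear ℝ ({p, q, r} : Set (EuclideanSpace ℝ (Fin 2)))) ∧
  (∀ u v : V, u ≠ v → (G.Adj u v ↔ ∃ n : ℤ, dist (f u) (f v) = (n : ℝ)))

/-- Two points of the plane are at integer distance. -/
def IsIntDist (A B : EuclideanSpace ℝ (Fin 2)) : Prop :=
  ∃ n : ℤ, dist A B = (n : ℝ)

theorem collinear_of_det_eq_zero {A B C : EuclideanSpace ℝ (Fin 2)}
    (h : (B 0 - A 0) * (C 1 - A 1) - (B 1 - A 1) * (C 0 - A 0) = 0) :
    Collinear ℝ ({A, B, C} : Set (EuclideanSpace ℝ (Fin 2))) := by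
  rcases eq_or_ne A B with rfl | hAB
  · simpa using collinear_pair ℝ A C
  have hpos : (B 0 - A 0) ^ 2 + (B 1 - A 1) ^ 2 ≠ 0 := by
    intro h0
    apply hAB
    have h1 : B 0 - A 0 = 0 := by nlinarith [sq_nonneg (B 0 - A 0), sq_nonneg (B 1 - A 1)]
    have h2 : B 1 - A 1 = 0 := by nlinarith [sq_nonneg (B 0 - A 0), sq_nonneg (B 1 - A 1)]
    ext i
    fin_cases i
    · simp; linarith
    · simp; linarith
  rw [collinear_iff_of_mem (p₀ := A) (by simp)]
  refine ⟨B - A, ?_⟩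
  rintro p (rfl | rfl | rfl)
  · exact ⟨0, by simp⟩
  · exact ⟨1, by simp⟩
  · refine ⟨((p 0 - A 0) * (B 0 - A 0) + (p 1 - A 1) * (B 1 - A 1)) /
      ((B 0 - A 0) ^ 2 + (B 1 - A 1) ^ 2), ?_⟩
    ext i
    fin_cases i
    · simp
      field_simp
      linear_combination (-(B 1 - A 1)) * h
    · simp
      field_simp
      linear_combination (B 0 - A 0) * h

theorem dist_sq_eq_coord (A B : EuclideanSpace ℝ (Fin 2)) :
    dist A B ^ 2 = (A 0 - B 0) ^ 2 + (A 1 - B 1) ^ 2 := by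
  rw [EuclideanSpace.dist_eq, Real.sq_sqrt (by positivity)]
  simp [Fin.sum_univ_two, Real.dist_eq, sq_abs]

/-- A point of the plane is determined by its distances to three noncollinear points. -/
theorem eq_of_dist_eq_of_not_collinear {A B C P Q : EuclideanSpace ℝ (Fin 2)}
    (h : ¬ Collinear ℝ ({A, B, C} : Set (EuclideanSpace ℝ (Fin 2))))
    (hA : dist P A = dist Q A) (hB : dist P B = dist Q B) (hC : dist P C = dist Q C) :
    P = Q := by
  have hd := mt collinear_of_det_eq_zero h
  have h1 := dist_sq_eq_coord P A
  have h2 := dist_sq_eq_coord P B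
  have h3 := dist_sq_eq_coord P C
  rw [hA, dist_sq_eq_coord] at h1
  rw [hB, dist_sq_eq_coord] at h2
  rw [hC, dist_sq_eq_coord] at h3
  have e0 : P 0 - Q 0 = 0 := by
    refine (mul_eq_zero.1 (?_ : _ * (P 0 - Q 0) = 0)).resolve_left hd
    linear_combination (C 1 - A 1) / 2 * (h2 - h1) - (B 1 - A 1) / 2 * (h3 - h1)
  have e1 : P 1 - Q 1 = 0 := by
    refine (mul_eq_zero.1 (?_ : _ * (P 1 - Q 1) = 0)).resolve_left hd
    linear_combination (B 0 - A 0) / 2 * (h3 - h1) - (C 0 - A 0) / 2 * (h2 - h1)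
  ext i
  fin_cases i
  · simp; linarith
  · simp; linarith

theorem le_of_quadratic_eq_zero {q₂ q₁ q₀ p : ℤ} (hp : 0 ≤ p)
    (h : q₂ * p ^ 2 + q₁ * p + q₀ = 0) (hne : q₀ = 0 → q₂ ≠ 0) :
    p ≤ |q₁| + |q₀| := by
  rcases hp.eq_or_lt with rfl | hp
  · positivity
  have hp1 : 1 ≤ p := hp
  rcases eq_or_ne q₂ 0 with h2 | h2
  · rcases eq_or_ne q₁ 0 with h1 | h1
    · exact absurd h2 (hne (by simpa [h1, h2] using h))
    · have h1' := Int.one_le_abs h1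
      have : |q₁| * p = |q₀| := by
        rw [← abs_neg q₀, show -q₀ = q₁ * p by rw [h2] at h; linarith, abs_mul, abs_of_pos hp]
      nlinarith
  · have h2' := Int.one_le_abs h2
    have e : |q₂| * p ^ 2 ≤ |q₁| * p + |q₀| := by
      calc |q₂| * p ^ 2 = |q₂ * p ^ 2| := by rw [abs_mul, abs_of_pos (by positivity : 0 < p ^ 2)]
        _ = |q₁ * p + q₀| := by rw [← abs_neg]; congr 1; linarith
        _ ≤ |q₁ * p| + |q₀| := abs_add_le _ _
        _ = |q₁| * p + |q₀| := by rw [abs_mul, abs_of_pos hp]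
    have e2 : |q₀| ≤ |q₀| * p := by nlinarith [abs_nonneg q₀]
    have e3 : p ^ 2 ≤ |q₂| * p ^ 2 := by nlinarith [sq_nonneg p]
    by_contra! hlt
    nlinarith

/-- A positive definite binary form vanishes only at the origin. -/
theorem eq_zero_of_form_eq_zero {b c h s t : ℤ} (hpos : 0 < 4 * c ^ 2 * b ^ 2 - h ^ 2)
    (h0 : s ^ 2 * b ^ 2 - s * t * h + t ^ 2 * c ^ 2 = 0) : s = 0 := by
  have e : (2 * c ^ 2 * t - h * s) ^ 2 + (4 * c ^ 2 * b ^ 2 - h ^ 2) * s ^ 2 = 0 := by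
    linear_combination 4 * c ^ 2 * h0
  by_contra hs
  have : 0 < (4 * c ^ 2 * b ^ 2 - h ^ 2) * s ^ 2 := by positivity
  nlinarith [sq_nonneg (2 * c ^ 2 * t - h * s)]

/-- The sum of the absolute values of the lower coefficients of the Cayley–Menger relation, as a
polynomial in the distance `p` to `A`, where `c, b, a` are the side lengths `AB, AC, BC` and the
distances to `B` and `C` are `p - k` and `p - l`. -/
def cayleyMengerBound (x : ℤ × ℤ × ℤ × ℤ × ℤ) : ℤ :=
  match x with
  | (c, b, a, k, l) =>
    |-(4 * k * (c ^ 2 - k ^ 2) * b ^ 2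
        - 2 * (k * (b ^ 2 - l ^ 2) + l * (c ^ 2 - k ^ 2)) * (c ^ 2 + b ^ 2 - a ^ 2)
        + 4 * l * (b ^ 2 - l ^ 2) * c ^ 2)| +
    |-((c ^ 2 - k ^ 2) ^ 2 * b ^ 2
        - (c ^ 2 - k ^ 2) * (b ^ 2 - l ^ 2) * (c ^ 2 + b ^ 2 - a ^ 2)
        + (b ^ 2 - l ^ 2) ^ 2 * c ^ 2)|

theorem le_cayleyMengerBound {A B C P : EuclideanSpace ℝ (Fin 2)}
    (h : ¬ Collinear ℝ ({A, B, C} : Set (EuclideanSpace ℝ (Fin 2)))) {c b a p q r : ℤ}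
    (hc : dist A B = c) (hb : dist A C = b) (ha : dist B C = a)
    (hp : dist P A = p) (hq : dist P B = q) (hr : dist P C = r) :
    p ≤ cayleyMengerBound (c, b, a, p - q, p - r) := by
  have hd := mt collinear_of_det_eq_zero h
  have hc' := dist_sq_eq_coord A B
  have hb' := dist_sq_eq_coord A C
  have ha' := dist_sq_eq_coord B C
  have hp' := dist_sq_eq_coord P A
  have hq' := dist_sq_eq_coord P B
  have hr' := dist_sq_eq_coord P C
  rw [hc] at hc'
  rw [hb] at hb'
  rw [ha] at ha'
  rw [hp] at hp'
  rw [hq] at hq'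
  rw [hr] at hr'
  have hp0 : 0 ≤ p := by
    have := dist_nonneg (x := P) (y := A)
    rw [hp] at this
    exact_mod_cast this
  obtain ⟨k, rfl⟩ : ∃ k, q = p - k := ⟨p - q, by ring⟩
  obtain ⟨l, rfl⟩ : ∃ l, r = p - l := ⟨p - r, by ring⟩
  rw [sub_sub_cancel, sub_sub_cancel]
  have hh : (c : ℝ) ^ 2 + b ^ 2 - a ^ 2 =
      2 * ((B 0 - A 0) * (C 0 - A 0) + (B 1 - A 1) * (C 1 - A 1)) := by
    rw [hc', hb', ha']; ring
  have hpos : 0 < 4 * c ^ 2 * b ^ 2 - (c ^ 2 + b ^ 2 - a ^ 2) ^ 2 := by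
    have : (0 : ℝ) < 4 * c ^ 2 * b ^ 2 - (c ^ 2 + b ^ 2 - a ^ 2) ^ 2 := by
      have e : (4 : ℝ) * c ^ 2 * b ^ 2 - (c ^ 2 + b ^ 2 - a ^ 2) ^ 2 =
          4 * ((B 0 - A 0) * (C 1 - A 1) - (B 1 - A 1) * (C 0 - A 0)) ^ 2 := by
        rw [hh, hc', hb']; ring
      rw [e]
      positivity
    exact_mod_cast this
  refine le_of_quadratic_eq_zero (q₂ := 4 * c ^ 2 * b ^ 2 - (c ^ 2 + b ^ 2 - a ^ 2) ^ 2
    - 4 * (k ^ 2 * b ^ 2 - k * l * (c ^ 2 + b ^ 2 - a ^ 2) + l ^ 2 * c ^ 2)) hp0 ?_ ?_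
  · have hS : 2 * (p : ℝ) * k + (c ^ 2 - k ^ 2) =
        2 * ((P 0 - A 0) * (B 0 - A 0) + (P 1 - A 1) * (B 1 - A 1)) := by
      push_cast at hq'
      linear_combination hp' - hq' + hc'
    have hT : 2 * (p : ℝ) * l + (b ^ 2 - l ^ 2) =
        2 * ((P 0 - A 0) * (C 0 - A 0) + (P 1 - A 1) * (C 1 - A 1)) := by
      push_cast at hr'
      linear_combination hp' - hr' + hb'
    have key : (p : ℝ) ^ 2 * (4 * c ^ 2 * b ^ 2 - (c ^ 2 + b ^ 2 - a ^ 2) ^ 2) -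
        ((2 * (p : ℝ) * k + (c ^ 2 - k ^ 2)) ^ 2 * b ^ 2
          - (2 * (p : ℝ) * k + (c ^ 2 - k ^ 2)) * (2 * (p : ℝ) * l + (b ^ 2 - l ^ 2)) *
            (c ^ 2 + b ^ 2 - a ^ 2)
          + (2 * (p : ℝ) * l + (b ^ 2 - l ^ 2)) ^ 2 * c ^ 2) = 0 := by
      rw [hS, hT, hh, hp', hc', hb']
      ring
    have key' : p ^ 2 * (4 * c ^ 2 * b ^ 2 - (c ^ 2 + b ^ 2 - a ^ 2) ^ 2) -
        ((2 * p * k + (c ^ 2 - k ^ 2)) ^ 2 * b ^ 2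
          - (2 * p * k + (c ^ 2 - k ^ 2)) * (2 * p * l + (b ^ 2 - l ^ 2)) *
            (c ^ 2 + b ^ 2 - a ^ 2)
          + (2 * p * l + (b ^ 2 - l ^ 2)) ^ 2 * c ^ 2) = 0 := by
      exact_mod_cast key
    linear_combination key'
  · intro h0 h2
    rw [neg_eq_zero] at h0
    have hs := eq_zero_of_form_eq_zero hpos h0
    have ht : b ^ 2 - l ^ 2 = 0 :=
      eq_zero_of_form_eq_zero (b := c) (c := b) (h := c ^ 2 + b ^ 2 - a ^ 2)
        (t := c ^ 2 - k ^ 2) (by linarith) (by linarith)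
    have e : (2 * k * l - (c ^ 2 + b ^ 2 - a ^ 2)) ^ 2 = 0 := by
      linear_combination -h2 + 4 * (b ^ 2 - l ^ 2) * hs
    have e' : c ^ 2 + b ^ 2 - a ^ 2 = 2 * k * l := by
      have := pow_eq_zero_iff (two_ne_zero) |>.1 e
      linarith
    rw [e'] at hpos
    have : 4 * c ^ 2 * b ^ 2 - (2 * k * l) ^ 2 = 0 := by
      linear_combination 4 * b ^ 2 * hs + 4 * k ^ 2 * ht
    linarith

/-- Points at integer distances from the vertices of a nondegenerate integral triangle are at
distance bounded in terms of the diameter of the triangle only. -/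
theorem exists_dist_bound (D : ℕ) : ∃ R : ℕ, ∀ A B C P : EuclideanSpace ℝ (Fin 2),
    ¬ Collinear ℝ ({A, B, C} : Set (EuclideanSpace ℝ (Fin 2))) →
    IsIntDist A B → IsIntDist A C → IsIntDist B C →
    IsIntDist P A → IsIntDist P B → IsIntDist P C →
    dist A B ≤ D → dist A C ≤ D → dist B C ≤ D →
    dist A B ≤ R ∧ dist A C ≤ R ∧ dist B C ≤ R ∧
      dist P A ≤ R ∧ dist P B ≤ R ∧ dist P C ≤ R := by
  obtain ⟨M, hM⟩ := ((Set.finite_Icc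
    (-(D : ℤ), -(D : ℤ), -(D : ℤ), -(D : ℤ), -(D : ℤ))
    ((D : ℤ), (D : ℤ), (D : ℤ), (D : ℤ), (D : ℤ))).image cayleyMengerBound).bddAbove
  refine ⟨M.toNat + D, ?_⟩
  intro A B C P hnc ⟨c, hc⟩ ⟨b, hb⟩ ⟨a, ha⟩ ⟨p, hp⟩ ⟨q, hq⟩ ⟨r, hr⟩ hcD hbD haD
  have hPA : dist P A ≤ M.toNat := by
    have h1 := le_cayleyMengerBound hnc hc hb ha hp hq hr
    have hk : |dist P A - dist P B| ≤ D := by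
      rw [dist_comm P A, dist_comm P B]
      exact (abs_dist_sub_le A B P).trans hcD
    have hl : |dist P A - dist P C| ≤ D := by
      rw [dist_comm P A, dist_comm P C]
      exact (abs_dist_sub_le A C P).trans hbD
    have hc' : |dist A B| ≤ D := by rwa [abs_of_nonneg dist_nonneg]
    have hb' : |dist A C| ≤ D := by rwa [abs_of_nonneg dist_nonneg]
    have ha' : |dist B C| ≤ D := by rwa [abs_of_nonneg dist_nonneg]
    rw [hp, hq] at hk
    rw [hp, hr] at hl
    rw [hc] at hc'
    rw [hb] at hb'
    rw [ha] at ha'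
    norm_cast at hk hl hc' hb' ha'
    rw [abs_le] at hk hl hc' hb' ha'
    have h2 : p ≤ M := h1.trans (hM ⟨_, ⟨⟨hc'.1, hb'.1, ha'.1, hk.1, hl.1⟩,
      ⟨hc'.2, hb'.2, ha'.2, hk.2, hl.2⟩⟩, rfl⟩)
    rw [hp]
    exact_mod_cast h2.trans M.self_le_toNat
  have hPB := dist_triangle P A B
  have hPC := dist_triangle P A C
  have hM0 : (0 : ℝ) ≤ M.toNat := by positivity
  have hD0 : (0 : ℝ) ≤ D := by positivity
  push_cast
  refine ⟨?_, ?_, ?_, ?_, ?_, ?_⟩ <;> linarith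

/-- At most `(R + 1) ^ 3` points have integer distances at most `R` from three noncollinear
points. -/
theorem card_le_of_isIntDist {n R : ℕ} {A B C : EuclideanSpace ℝ (Fin 2)}
    (h : ¬ Collinear ℝ ({A, B, C} : Set (EuclideanSpace ℝ (Fin 2))))
    {g : Fin n → EuclideanSpace ℝ (Fin 2)} (hg : Function.Injective g)
    (hi : ∀ i, IsIntDist (g i) A ∧ IsIntDist (g i) B ∧ IsIntDist (g i) C)
    (hR : ∀ i, dist (g i) A ≤ R ∧ dist (g i) B ≤ R ∧ dist (g i) C ≤ R) :
    n ≤ (R + 1) ^ 3 := by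
  have floor_dist : ∀ {P Q : EuclideanSpace ℝ (Fin 2)}, IsIntDist P Q →
      ((⌊dist P Q⌋₊ : ℕ) : ℝ) = dist P Q := by
    rintro P Q ⟨m, hm⟩
    have h0 : 0 ≤ m := by
      have := dist_nonneg (x := P) (y := Q)
      rw [hm] at this
      exact_mod_cast this
    lift m to ℕ using h0
    rw [hm]
    simp
  have lt_of_le : ∀ {x : ℝ}, x ≤ R → ⌊x⌋₊ < R + 1 := fun hx =>
    Nat.lt_succ_of_le (Nat.floor_le_of_le hx)
  let φ : Fin n → Fin (R + 1) × Fin (R + 1) × Fin (R + 1) := fun i =>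
    (⟨⌊dist (g i) A⌋₊, lt_of_le (hR i).1⟩, ⟨⌊dist (g i) B⌋₊, lt_of_le (hR i).2.1⟩,
      ⟨⌊dist (g i) C⌋₊, lt_of_le (hR i).2.2⟩)
  have hφ : Function.Injective φ := by
    intro i j hij
    simp only [φ, Prod.mk.injEq, Fin.mk.injEq] at hij
    obtain ⟨h1, h2, h3⟩ := hij
    refine hg (eq_of_dist_eq_of_not_collinear h ?_ ?_ ?_)
    · rw [← floor_dist (hi i).1, ← floor_dist (hi j).1, h1]
    · rw [← floor_dist (hi i).2.1, ← floor_dist (hi j).2.1, h2]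
    · rw [← floor_dist (hi i).2.2, ← floor_dist (hi j).2.2, h3]
  have := Fintype.card_le_of_injective φ hφ
  simp only [Fintype.card_fin, Fintype.card_prod] at this
  linarith [pow_succ (R + 1) 2, pow_two (R + 1), mul_assoc (R + 1) (R + 1) (R + 1)]

/-- The graph whose vertices are adjacent when they lie in distinct layers at most `5` apart. -/
def layeredGraph {V : Type*} (layer : V → ℕ) : SimpleGraph V where
  Adj u v := layer u ≠ layer v ∧ layer u ≤ layer v + 5 ∧ layer v ≤ layer u + 5
  symm := ⟨fun _ _ h => ⟨h.1.symm, h.2.2, h.2.1⟩⟩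
  loopless := ⟨fun _ h => h.1 rfl⟩

theorem layeredGraph_neighborSet_finite {V : Type*} {layer : V → ℕ}
    (hfin : ∀ i, (layer ⁻¹' {i}).Finite) (v : V) :
    ((layeredGraph layer).neighborSet v).Finite := by
  refine ((Set.finite_Iic (layer v + 5)).biUnion fun i _ => hfin i).subset fun u hu => ?_
  simp only [Set.mem_iUnion]
  exact ⟨layer u, hu.2.2, rfl⟩

theorem layeredGraph_chromaticNumber {V : Type*} {layer : V → ℕ}
    (hsurj : Function.Surjective layer) : (layeredGraph layer).chromaticNumber = 6 := by
  apply le_antisymm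
  · refine SimpleGraph.Colorable.chromaticNumber_le (n := 6) ⟨SimpleGraph.Coloring.mk
      (fun v => (⟨layer v % 6, Nat.mod_lt _ (by norm_num)⟩ : Fin 6)) ?_⟩
    rintro u v ⟨h1, h2, h3⟩ h
    simp only [Fin.mk.injEq] at h
    omega
  · choose x hx using hsurj
    have hinj : Function.Injective x := fun i j h => by rw [← hx i, h, hx j]
    have hcl : (layeredGraph layer).IsClique
        (((Finset.range 6).map ⟨x, hinj⟩ : Finset V) : Set V) := by
      intro u hu v hv huv
      simp only [Finset.coe_map, Function.Embedding.coeFn_mk, Set.mem_image, Finset.coe_range,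
        Set.mem_Iio] at hu hv
      obtain ⟨i, hi, rfl⟩ := hu
      obtain ⟨j, hj, rfl⟩ := hv
      have hij : i ≠ j := fun h => huv (by rw [h])
      refine ⟨?_, ?_, ?_⟩ <;> simp only [hx] <;> omega
    simpa using hcl.card_le_chromaticNumber

theorem exists_locally_finite_chromatic_six_non_integral_graph :
    ∃ G : SimpleGraph ℕ,
      (∀ v : ℕ, (G.neighborSet v).Finite) ∧
      G.chromaticNumber = 6 ∧
      ¬ ∃ f : ℕ → EuclideanSpace ℝ (Fin 2), IsIntegralRealization G f := by
  choose R hR using exists_dist_bound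
  let w : ℕ → ℕ := fun i => (R (R^[i + 1] i) + 1) ^ 3 + 1
  have hw : ∀ i, NeZero (w i) := fun i => ⟨Nat.succ_ne_zero _⟩
  have hinf : Infinite (Σ i, Fin (w i)) :=
    Infinite.of_injective (fun i => (⟨i, 0⟩ : Σ i, Fin (w i)))
      fun i j h => congrArg Sigma.fst h
  obtain ⟨e⟩ : Nonempty ((Σ i, Fin (w i)) ≃ ℕ) := nonempty_equiv_of_countable
  let layer : ℕ → ℕ := fun v => (e.symm v).1
  have hlayer : ∀ i (j : Fin (w i)), layer (e ⟨i, j⟩) = i := fun i j => by simp [layer]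
  refine ⟨layeredGraph layer, layeredGraph_neighborSet_finite fun i => ?_,
    layeredGraph_chromaticNumber fun i => ⟨e ⟨i, 0⟩, hlayer i 0⟩, ?_⟩
  · refine (Set.finite_range fun j : Fin (w i) => e ⟨i, j⟩).subset fun v hv => ?_
    obtain rfl : (e.symm v).1 = i := hv
    exact ⟨(e.symm v).2, by simp⟩
  rintro ⟨f, hf, hcol, hadj⟩
  have hlayer_dist : ∀ {u v}, layer u ≠ layer v → layer u ≤ layer v + 5 → layer v ≤ layer u + 5 →
      IsIntDist (f u) (f v) := fun h1 h2 h3 =>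
    (hadj _ _ fun h => h1 (by rw [h])).1 ⟨h1, h2, h3⟩
  let X : ℕ → EuclideanSpace ℝ (Fin 2) := fun i => f (e ⟨i, 0⟩)
  have hX : ∀ i j, i ≠ j → i ≤ j + 5 → j ≤ i + 5 → IsIntDist (X i) (X j) := fun i j h1 h2 h3 =>
    hlayer_dist (by rwa [hlayer, hlayer]) (by rwa [hlayer, hlayer]) (by rwa [hlayer, hlayer])
  have hXinj : Function.Injective X := fun i j h => by
    have := congrArg layer (hf h)
    rwa [hlayer, hlayer] at this
  have hXcol : ∀ i, ¬ Collinear ℝ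
      ({X i, X (i + 1), X (i + 2)} : Set (EuclideanSpace ℝ (Fin 2))) := fun i =>
    hcol _ _ _ ⟨_, rfl⟩ ⟨_, rfl⟩ ⟨_, rfl⟩ (hXinj.ne (by omega)) (hXinj.ne (by omega))
      (hXinj.ne (by omega))
  obtain ⟨D, hD⟩ := exists_nat_ge (dist (X 0) (X 1) + dist (X 0) (X 2) + dist (X 1) (X 2))
  have hdiam : ∀ n, dist (X n) (X (n + 1)) ≤ R^[n] D ∧ dist (X n) (X (n + 2)) ≤ R^[n] D ∧
      dist (X (n + 1)) (X (n + 2)) ≤ R^[n] D := by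
    intro n
    induction n with
    | zero =>
      have h1 := dist_nonneg (x := X 0) (y := X 1)
      have h2 := dist_nonneg (x := X 0) (y := X 2)
      have h3 := dist_nonneg (x := X 1) (y := X 2)
      simp only [Function.iterate_zero, id_eq, zero_add]
      refine ⟨?_, ?_, ?_⟩ <;> linarith
    | succ n ih =>
      obtain ⟨-, -, h3, -, h5, h6⟩ := hR (R^[n] D) (X n) (X (n + 1)) (X (n + 2)) (X (n + 3))
        (hXcol n) (hX _ _ (by omega) (by omega) (by omega))
        (hX _ _ (by omega) (by omega) (by omega)) (hX _ _ (by omega) (by omega) (by omega))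
        (hX _ _ (by omega) (by omega) (by omega)) (hX _ _ (by omega) (by omega) (by omega))
        (hX _ _ (by omega) (by omega) (by omega)) ih.1 ih.2.1 ih.2.2
      rw [Function.iterate_succ_apply']
      exact ⟨h3, by rwa [dist_comm], by rwa [dist_comm]⟩
  obtain ⟨d1, d2, d3⟩ := hdiam (D + 1)
  have hLX : ∀ (j : Fin (w D)) (k : ℕ), k ≠ D → k ≤ D + 5 → D ≤ k + 5 →
      IsIntDist (f (e ⟨D, j⟩)) (X k) := fun j k h1 h2 h3 =>
    hlayer_dist (by rw [hlayer, hlayer]; exact h1.symm) (by rwa [hlayer, hlayer])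
      (by rwa [hlayer, hlayer])
  have hLi : ∀ j : Fin (w D), IsIntDist (f (e ⟨D, j⟩)) (X (D + 1)) ∧
      IsIntDist (f (e ⟨D, j⟩)) (X (D + 1 + 1)) ∧ IsIntDist (f (e ⟨D, j⟩)) (X (D + 1 + 2)) :=
    fun j => ⟨hLX j _ (by omega) (by omega) (by omega), hLX j _ (by omega) (by omega) (by omega),
      hLX j _ (by omega) (by omega) (by omega)⟩
  have hcard : w D ≤ (R (R^[D + 1] D) + 1) ^ 3 := by
    refine card_le_of_isIntDist (hXcol (D + 1)) (g := fun j => f (e ⟨D, j⟩)) ?_ hLi fun j => ?_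
    · intro i j h
      simpa using e.injective (hf h)
    · exact (hR _ _ _ _ _ (hXcol (D + 1)) (hX _ _ (by omega) (by omega) (by omega))
        (hX _ _ (by omega) (by omega) (by omega)) (hX _ _ (by omega) (by omega) (by omega))
        (hLi j).1 (hLi j).2.1 (hLi j).2.2 d1 d2 d3).2.2.2
  exact absurd hcard (Nat.not_succ_le_self _)
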